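/- Let G be a connected finite simple graph, let a be a vertex of G, and let D_1, …, D_k with k ≥ 2 be the vertex sets of the connected components of G − a; for each i let G_i be the subgraph of G induced on {a} ∪ D_i. If τ is a chord model of G, then τ is equivalent (equal up to rotation) to a cyclic word of the form a μ_{i_1} ⋯ μ_{i_k} a μ'_{i_k} ⋯ μ'_{i_1}, where i_1, …, i_k is a permutation of [k] and, for every j ∈ [k], a μ_{i_j} a μ'_{i_j} is a chord model of G_{i_j}. -/

import Mathlib

/-- The two occurrences of `u` and the two occurrences of `v` alternate in the
(cyclic) word represented by the list `l`. -/
def ChordsAlternate {V : Type*} (l : List V) (u v : V) : Prop :=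
  ∀ i₁ i₂ j₁ j₂ : Fin l.length, i₁ < i₂ → j₁ < j₂ →
    l.get i₁ = u → l.get i₂ = u → l.get j₁ = v → l.get j₂ = v →
    ((i₁ < j₁ ∧ j₁ < i₂ ∧ i₂ < j₂) ∨ (j₁ < i₁ ∧ i₁ < j₂ ∧ j₂ < i₂))

/-- `l` is a chord model of the graph `G` restricted to the vertex set `S`
(i.e. of the subgraph of `G` induced on `S`). -/
def IsChordModelOn {V : Type*} [DecidableEq V] (G : SimpleGraph V) (S : Finset V)
    (l : List V) : Prop :=
  (∀ v ∈ S, l.count v = 2) ∧ (∀ v : V, v ∉ S → l.count v = 0) ∧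
    ∀ u ∈ S, ∀ v ∈ S, u ≠ v → (G.Adj u v ↔ ChordsAlternate l u v)

open scoped List

theorem four_sublist_of_lt {V : Type*} {l : List V} {i j m n : Fin l.length}
    (hij : i < j) (hjm : j < m) (hmn : m < n) :
    [l.get i, l.get j, l.get m, l.get n] <+ l := by
  have h := List.map_getElem_sublist (l := l) (is := [i, j, m, n]) (by grind)
  simpa using h

theorem exists_lt_of_four_sublist {V : Type*} {l : List V} {x y z w : V}
    (h : [x, y, z, w] <+ l) :
    ∃ i j m n : Fin l.length, i < j ∧ j < m ∧ m < n ∧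
      l.get i = x ∧ l.get j = y ∧ l.get m = z ∧ l.get n = w := by
  obtain ⟨is, his, hp⟩ := List.sublist_eq_map_getElem h
  match is, his, hp with
  | [i, j, m, n], his, hp =>
    simp only [List.map_cons, List.map_nil, List.cons.injEq] at his
    simp only [List.pairwise_cons, List.mem_cons] at hp
    exact ⟨i, j, m, n, hp.1 j (by simp), hp.2.1 m (by simp), hp.2.2.1 n (by simp),
      his.1.symm, his.2.1.symm, his.2.2.1.symm, his.2.2.2.1.symm⟩

theorem exists_lt_of_count_eq_two {V : Type*} [DecidableEq V] {l : List V} {v : V}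
    (h : l.count v = 2) : ∃ i j : Fin l.length, i < j ∧ l.get i = v ∧ l.get j = v := by
  have hd : l.Duplicate v := List.duplicate_iff_two_le_count.2 h.ge
  obtain ⟨i, j, hij, hi, hj⟩ := List.duplicate_iff_exists_distinct_get.1 hd
  exact ⟨i, j, hij, hi.symm, hj.symm⟩

theorem eq_or_eq_of_count_eq_two {V : Type*} [DecidableEq V] {l : List V} {v : V}
    (h : l.count v = 2) {i j m : Fin l.length} (hij : i < j)
    (hi : l.get i = v) (hj : l.get j = v) (hm : l.get m = v) : m = i ∨ m = j := by
  by_contra! hne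
  have key : ∀ p q r : Fin l.length, p < q → q < r →
      l.get p = v → l.get q = v → l.get r = v → False := by
    intro p q r hpq hqr hp hq hr
    have hs := List.map_getElem_sublist (l := l) (is := [p, q, r]) (by grind)
    have hc := hs.count_le v
    simp_all
  rcases lt_or_gt_of_ne hne.1 with h1 | h1
  · exact key m i j h1 hij hm hi hj
  · rcases lt_or_gt_of_ne hne.2 with h2 | h2
    · exact key i m j h1 h2 hi hm hj
    · exact key i j m hij h2 hi hj hm

theorem length_filter_pair {V : Type*} [DecidableEq V] (l : List V) {u v : V} (huv : u ≠ v) :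
    (l.filter (fun x => x = u ∨ x = v)).length = l.count u + l.count v := by
  induction l with
  | nil => simp
  | cons b l ih => grind

/-- For two letters occurring twice, alternation can be read off the subword they form. -/
theorem chordsAlternate_iff_filter {V : Type*} [DecidableEq V] {l : List V} {u v : V}
    (huv : u ≠ v) (hu : l.count u = 2) (hv : l.count v = 2) :
    ChordsAlternate l u v ↔
      l.filter (fun x => x = u ∨ x = v) = [u, v, u, v] ∨
      l.filter (fun x => x = u ∨ x = v) = [v, u, v, u] := by
  have hlen := length_filter_pair l huv
  have hcu : (l.filter (fun x => x = u ∨ x = v)).count u = 2 := by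
    rw [List.count_filter (by simp), hu]
  have hcv : (l.filter (fun x => x = u ∨ x = v)).count v = 2 := by
    rw [List.count_filter (by simp), hv]
  have hsub : ∀ x y z w : V, [x, y, z, w] <+ l → (∀ b ∈ [x, y, z, w], b = u ∨ b = v) →
      l.filter (fun x => x = u ∨ x = v) = [x, y, z, w] := by
    intro x y z w hs hb
    have h := hs.filter (fun x => decide (x = u ∨ x = v))
    rw [List.filter_eq_self.2 (by simpa using hb)] at h
    exact (h.eq_of_length (by rw [hlen, hu, hv]; rfl)).symm
  constructor
  · intro h
    obtain ⟨i, i', hii, hi, hi'⟩ := exists_lt_of_count_eq_two hu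
    obtain ⟨j, j', hjj, hj, hj'⟩ := exists_lt_of_count_eq_two hv
    rcases h i i' j j' hii hjj hi hi' hj hj' with ⟨h1, h2, h3⟩ | ⟨h1, h2, h3⟩
    · left
      have := four_sublist_of_lt h1 h2 h3
      rw [hi, hi', hj, hj'] at this
      exact hsub _ _ _ _ this (by simp)
    · right
      have := four_sublist_of_lt h1 h2 h3
      rw [hi, hi', hj, hj'] at this
      exact hsub _ _ _ _ this (by simp)
  · intro h i i' j j' hii hjj hi hi' hj hj'
    obtain ⟨p, q, r, s, hpq, hqr, hrs, hcase⟩ : ∃ p q r s : Fin l.length,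
        p < q ∧ q < r ∧ r < s ∧
        ((l.get p = u ∧ l.get q = v ∧ l.get r = u ∧ l.get s = v) ∨
         (l.get p = v ∧ l.get q = u ∧ l.get r = v ∧ l.get s = u)) := by
      rcases h with h | h
      · obtain ⟨p, q, r, s, h⟩ := exists_lt_of_four_sublist (h ▸ List.filter_sublist)
        exact ⟨p, q, r, s, h.1, h.2.1, h.2.2.1, Or.inl h.2.2.2⟩
      · obtain ⟨p, q, r, s, h⟩ := exists_lt_of_four_sublist (h ▸ List.filter_sublist)
        exact ⟨p, q, r, s, h.1, h.2.1, h.2.2.1, Or.inr h.2.2.2⟩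
    rcases hcase with ⟨hp, hq, hr, hs⟩ | ⟨hp, hq, hr, hs⟩
    · have e1 := eq_or_eq_of_count_eq_two hu hii hi hi' hp
      have e2 := eq_or_eq_of_count_eq_two hu hii hi hi' hr
      have e3 := eq_or_eq_of_count_eq_two hv hjj hj hj' hq
      have e4 := eq_or_eq_of_count_eq_two hv hjj hj hj' hs
      grind
    · have e1 := eq_or_eq_of_count_eq_two hv hjj hj hj' hp
      have e2 := eq_or_eq_of_count_eq_two hu hii hi hi' hq
      have e3 := eq_or_eq_of_count_eq_two hv hjj hj hj' hr
      have e4 := eq_or_eq_of_count_eq_two hu hii hi hi' hs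
      grind

theorem IsChordModelOn.swap {V : Type*} [DecidableEq V] {G : SimpleGraph V} {S : Finset V}
    {s t : List V} (h : IsChordModelOn G S (s ++ t)) : IsChordModelOn G S (t ++ s) := by
  obtain ⟨h1, h2, h3⟩ := h
  have hc : ∀ v, (t ++ s).count v = (s ++ t).count v := fun v => by
    simp [add_comm]
  refine ⟨fun v hv => (hc v).trans (h1 v hv), fun v hv => (hc v).trans (h2 v hv), ?_⟩
  intro u hu v hv huv
  rw [h3 u hu v hv huv, chordsAlternate_iff_filter huv (h1 u hu) (h1 v hv),
    chordsAlternate_iff_filter huv ((hc u).trans (h1 u hu)) ((hc v).trans (h1 v hv))]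
  simp only [List.filter_append]
  have key : ∀ (x y : V) (p q : List V),
      (p ++ q = [x, y, x, y] ∨ p ++ q = [y, x, y, x]) →
      (q ++ p = [x, y, x, y] ∨ q ++ p = [y, x, y, x]) := by
    intro x y p q hpq
    rcases p with _ | ⟨p1, _ | ⟨p2, _ | ⟨p3, _ | ⟨p4, p⟩⟩⟩⟩ <;>
      simp at hpq ⊢ <;> grind
  exact ⟨key u v _ _, key u v _ _⟩

theorem IsChordModelOn.filter {V : Type*} [DecidableEq V] {G : SimpleGraph V}
    {S T : Finset V} {l : List V} (h : IsChordModelOn G S l) (hT : T ⊆ S) :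
    IsChordModelOn G T (l.filter (· ∈ T)) := by
  obtain ⟨h1, h2, h3⟩ := h
  have hc : ∀ v ∈ T, (l.filter (· ∈ T)).count v = 2 := fun v hv => by
    rw [List.count_filter (by simpa using hv), h1 v (hT hv)]
  refine ⟨hc, fun v hv => List.count_eq_zero.2 (by simp [hv]), ?_⟩
  intro u hu v hv huv
  rw [h3 u (hT hu) v (hT hv) huv,
    chordsAlternate_iff_filter huv (h1 u (hT hu)) (h1 v (hT hv)),
    chordsAlternate_iff_filter huv (hc u hu) (hc v hv)]
  have : (l.filter (· ∈ T)).filter (fun x => x = u ∨ x = v) =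
      l.filter (fun x => x = u ∨ x = v) := by
    rw [List.filter_filter]
    refine List.filter_congr fun x _ => ?_
    by_cases hx : x = u ∨ x = v
    · rcases hx with rfl | rfl <;> simp [hu, hv]
    · simp [hx]
  rw [this]

theorem IsChordModelOn.not_crossing_interval {V : Type*} [DecidableEq V] {G : SimpleGraph V}
    {S D : Finset V} {l : List V} (h : IsChordModelOn G S l) (hD : D ⊆ S)
    (hconn : (G.induce (D : Set V)).Connected) {p q : Fin l.length}
    (hpq : ∀ v ∈ D, ∀ x y : Fin l.length, l.get x = v → l.get y = v →
      p < x → x < q → p < y ∧ y < q)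
    {x y : Fin l.length} (hx : l.get x ∈ D) (hy : l.get y ∈ D) (hpx : p < x) (hxq : x < q) :
    p < y ∧ y < q := by
  have step : ∀ (u v : (D : Set V)), (G.induce (D : Set V)).Walk u v →
      (∃ i : Fin l.length, l.get i = u ∧ p < i ∧ i < q) →
      (∃ i : Fin l.length, l.get i = v ∧ p < i ∧ i < q) := by
    intro u v w
    induction w with
    | nil => exact id
    | @cons u v w huv _ ih =>
      rintro ⟨i, hi, hpi, hiq⟩
      apply ih
      have hu : (u : V) ∈ D := u.2
      have hv : (v : V) ∈ D := v.2
      have hadj : G.Adj u v := huv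
      have halt := (h.2.2 u (hD hu) v (hD hv) hadj.ne).1 hadj
      obtain ⟨i1, i2, hii, hi1, hi2⟩ := exists_lt_of_count_eq_two (h.1 u (hD hu))
      obtain ⟨j1, j2, hjj, hj1, hj2⟩ := exists_lt_of_count_eq_two (h.1 v (hD hv))
      have a1 := hpq u hu i i1 hi hi1 hpi hiq
      have a2 := hpq u hu i i2 hi hi2 hpi hiq
      rcases halt i1 i2 j1 j2 hii hjj hi1 hi2 hj1 hj2 with hh | hh
      · exact ⟨j1, hj1, by grind, by grind⟩
      · exact ⟨j2, hj2, by grind, by grind⟩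
  obtain ⟨w⟩ := hconn.preconnected ⟨l.get x, hx⟩ ⟨l.get y, hy⟩
  obtain ⟨i, hi, hpi, hiq⟩ := step _ _ w ⟨x, rfl, hpx, hxq⟩
  exact hpq _ hy i y hi rfl hpi hiq

/-- Connected vertex sets without edges between them do not cross in a chord model. -/
theorem IsChordModelOn.not_crossing {V : Type*} [DecidableEq V] {G : SimpleGraph V}
    {S D E : Finset V} {l : List V} (h : IsChordModelOn G S l) (hD : D ⊆ S) (hE : E ⊆ S)
    (hDconn : (G.induce (D : Set V)).Connected) (hEconn : (G.induce (E : Set V)).Connected)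
    (hdisj : Disjoint D E) (hsep : ∀ u ∈ D, ∀ v ∈ E, ¬ G.Adj u v)
    {x y x' y' : V} (hx : x ∈ D) (hx' : x' ∈ D) (hy : y ∈ E) (hy' : y' ∈ E) :
    ¬ [x, y, x', y'] <+ l := by
  intro hs
  obtain ⟨p, q, p', q', hpq, hqp, hpq', rfl, rfl, rfl, rfl⟩ := exists_lt_of_four_sublist hs
  have hchord : ∀ v ∈ E, ∀ i j : Fin l.length, i < j → l.get i = v → l.get j = v →
      ∀ u ∈ D, ∀ s t : Fin l.length, l.get s = u → l.get t = u →
        i < s → s < j → i < t ∧ t < j := by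
    intro v hv i j hij hi hj u hu s t hs ht his hsj
    have huv : u ≠ v := fun e => Finset.disjoint_left.1 hdisj hu (e ▸ hv)
    have hna := mt (h.2.2 u (hD hu) v (hE hv) huv).2 (hsep u hu v hv)
    by_contra hcon
    apply hna
    have hsi : t ≠ i := by rintro rfl; exact huv (ht.symm.trans hi)
    have hsj' : t ≠ j := by rintro rfl; exact huv (ht.symm.trans hj)
    intro i1 i2 j1 j2 hii hjj hi1 hi2 hj1 hj2
    have e1 := eq_or_eq_of_count_eq_two (h.1 u (hD hu)) hii hi1 hi2 hs
    have e2 := eq_or_eq_of_count_eq_two (h.1 u (hD hu)) hii hi1 hi2 ht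
    have e3 := eq_or_eq_of_count_eq_two (h.1 v (hE hv)) hjj hj1 hj2 hi
    have e4 := eq_or_eq_of_count_eq_two (h.1 v (hE hv)) hjj hj1 hj2 hj
    grind
  have hout : p < q' ∧ q' < p' := by
    refine h.not_crossing_interval hE hEconn (p := p) (q := p') ?_ hy hy' hpq hqp
    intro v hv s t hs ht hps hsp
    have hpt : p ≠ t := by
      rintro rfl; exact Finset.disjoint_left.1 hdisj hx (ht ▸ hv)
    have hpt' : p' ≠ t := by
      rintro rfl; exact Finset.disjoint_left.1 hdisj hx' (ht ▸ hv)
    by_contra hcon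
    rcases lt_trichotomy s t with hst | hst | hst
    · have := h.not_crossing_interval hD hDconn (hchord v hv s t hst hs ht) hx' hx
      grind
    · grind
    · have := h.not_crossing_interval hD hDconn (hchord v hv t s hst ht hs) hx hx'
      grind
  exact absurd hout.2 (not_lt.2 hpq'.le)

theorem exists_cons_sublist_of_findIdx_lt {V : Type*} {p q : V → Bool} {w : List V}
    (h : w.findIdx p < w.findIdx q) {y : V} {t : List V} (hy : q y) (hs : y :: t <+ w) :
    ∃ z, p z ∧ z :: y :: t <+ w := by
  induction w with
  | nil => simp at hs
  | cons b w ih =>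
    have hqb : q b = false := by
      by_contra hb
      rw [Bool.not_eq_false] at hb
      simp [List.findIdx_cons, hb] at h
    have hs' : y :: t <+ w := by
      cases hs with
      | cons _ hs => exact hs
      | cons_cons _ hs => simp [hqb] at hy
    by_cases hpb : p b
    · exact ⟨b, hpb, hs'.cons_cons b⟩
    · obtain ⟨z, hz, hzs⟩ := ih (by simpa [List.findIdx_cons, hpb, hqb] using h) hs'
      exact ⟨z, hz, hzs.cons b⟩

theorem eq_filter_append_filter_not {V : Type*} {p : V → Bool} {l : List V}
    (h : l.Pairwise fun x y => p y → p x) :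
    l = l.filter p ++ l.filter (fun x => !p x) := by
  induction l with
  | nil => rfl
  | cons b l ih =>
    rw [List.pairwise_cons] at h
    by_cases hb : p b
    · simpa [hb] using ih h.2
    · have : ∀ x ∈ l, ¬ p x := fun x hx hp => hb (h.1 x hx hp)
      rw [List.filter_eq_nil_iff.2 (by simpa [hb] using this), List.nil_append, eq_comm,
        List.filter_eq_self]
      simpa [hb] using this

/-- A word whose letters are sorted by class is the concatenation of its classes. -/
theorem eq_flatten_filter {V ι : Type*} {P : ι → V → Bool} {js : List ι} {l : List V}
    (hjs : js.Pairwise fun i j => ∀ x y, P i y → P j x → ¬ [x, y] <+ l)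
    (hexcl : js.Pairwise fun i j => ∀ x, P i x → ¬ P j x)
    (hl : ∀ x ∈ l, ∃ j ∈ js, P j x) :
    l = (js.map fun j => l.filter (P j)).flatten := by
  induction js generalizing l with
  | nil => simpa [List.eq_nil_iff_forall_not_mem] using hl
  | cons j js ih =>
    rw [List.pairwise_cons] at hjs hexcl
    have hsplit : l = l.filter (P j) ++ l.filter (fun x => !P j x) := by
      apply eq_filter_append_filter_not
      rw [List.pairwise_iff_forall_sublist]
      intro x y hxy hy
      obtain ⟨i, hi, hix⟩ := hl x (hxy.subset (by simp))
      rcases List.mem_cons.1 hi with rfl | hi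
      · exact hix
      · exact absurd hxy (hjs.1 i hi x y hy hix)
    have htail := ih (l := l.filter (fun x => !P j x))
      (hjs.2.imp fun h x y hx hy hs => h x y hx hy (hs.trans List.filter_sublist)) hexcl.2
      (by
        intro x hx
        rw [List.mem_filter] at hx
        obtain ⟨i, hi, hix⟩ := hl x hx.1
        rcases List.mem_cons.1 hi with rfl | hi
        · simp [hix] at hx
        · exact ⟨i, hi, hix⟩)
    have hmap : (js.map fun i => (l.filter (fun x => !P j x)).filter (P i)) =
        js.map fun i => l.filter (P i) := by
      refine List.map_congr_left fun i hi => ?_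
      rw [List.filter_filter]
      refine List.filter_congr fun x _ => ?_
      by_cases hpi : P i x
      · simp [hpi, mt (hexcl.1 i hi x) (not_not.2 hpi)]
      · simp [hpi]
    rw [hmap] at htail
    rw [List.map_cons, List.flatten_cons, ← htail]
    exact hsplit

theorem IsChordModelOn.mem_and_mem_of_adj {V : Type*} [DecidableEq V] {G : SimpleGraph V}
    {S : Finset V} {a u : V} {w w' : List V} (h : IsChordModelOn G S (a :: w ++ a :: w'))
    (ha : a ∈ S) (hu : u ∈ S) (hau : G.Adj a u) : u ∈ w ∧ u ∈ w' := by
  have hne : u ≠ a := hau.ne'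
  have hca := h.1 a ha
  have hw : a ∉ w ∧ a ∉ w' := by
    simp only [← List.count_eq_zero]
    simp at hca
    omega
  have hf := (chordsAlternate_iff_filter hau.ne (h.1 a ha) (h.1 u hu)).1
    ((h.2.2 a ha u hu hau.ne).1 hau)
  have hnil : ∀ t : List V, a ∉ t → u ∉ t → t.filter (fun x => x = a ∨ x = u) = [] := by
    intro t hat hut
    rw [List.filter_eq_nil_iff]
    grind
  simp only [List.filter_append, List.filter_cons] at hf
  constructor
  · by_contra hc
    rw [hnil w hw.1 hc] at hf
    grind
  · by_contra hc
    rw [hnil w' hw.2 hc] at hf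
    have hl := hf.imp (congrArg List.getLast?) (congrArg List.head?)
    simp [hne.symm] at hl
    rw [← List.cons_append, List.getLast?_concat] at hl
    exact hne (Option.some.inj hl).symm

theorem exists_rotate_eq_of_count_eq_two {V : Type*} [DecidableEq V] {l : List V} {a : V}
    (h : l.count a = 2) :
    ∃ (s t w w' : List V), l = s ++ t ∧ t ++ s = a :: w ++ a :: w' := by
  obtain ⟨s, t, rfl⟩ := List.append_of_mem (List.count_pos_iff.1 (h ▸ Nat.two_pos))
  have hts : a ∈ t ++ s := by
    rw [← List.count_pos_iff]
    simp at h ⊢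
    grind
  obtain ⟨w, w', hw⟩ := List.append_of_mem hts
  exact ⟨s, a :: t, w, w', rfl, by simpa using hw⟩

theorem chord_model_decomposition_articulation_point
    {V : Type*} [Fintype V] [DecidableEq V] (G : SimpleGraph V)
    (hconn : G.Connected) (a : V)
    (k : ℕ) (hk : 2 ≤ k) (D : Fin k → Finset V)
    -- `D 0, …, D (k-1)` are the vertex sets of the connected components of `G - a`:
    (hDdisj : ∀ i j, i ≠ j → Disjoint (D i) (D j))
    (hDcover : Finset.univ.biUnion D = Finset.univ.erase a)
    (hDconn : ∀ i, (G.induce ((D i : Finset V) : Set V)).Connected)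
    (hDsep : ∀ i j, i ≠ j → ∀ u ∈ D i, ∀ v ∈ D j, ¬ G.Adj u v)
    (l : List V) (hl : IsChordModelOn G Finset.univ l) :
    ∃ (σ : Equiv.Perm (Fin k)) (μ μ' : Fin k → List V) (r : ℕ),
      l.rotate r =
        a :: (List.ofFn (fun j => μ (σ j))).flatten ++
          a :: ((List.ofFn (fun j => μ' (σ j))).reverse).flatten ∧
      ∀ i, IsChordModelOn G (insert a (D i)) (a :: μ i ++ a :: μ' i) := by
  obtain ⟨s, t, w, w', rfl, hts⟩ := exists_rotate_eq_of_count_eq_two (hl.1 a (Finset.mem_univ a))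
  have hL : IsChordModelOn G Finset.univ (a :: w ++ a :: w') := hts ▸ hl.swap
  have hmem : ∀ v, v ≠ a ↔ ∃ i, v ∈ D i := fun v => by
    have := Finset.ext_iff.1 hDcover v
    simpa using this.symm
  have haw : a ∉ w ∧ a ∉ w' := by
    have hca := hL.1 a (Finset.mem_univ a)
    simp only [← List.count_eq_zero]
    simp at hca
    omega
  have hunique : ∀ i j v, v ∈ D i → v ∈ D j → i = j := fun i j v hi hj => by
    by_contra hne
    exact Finset.disjoint_left.1 (hDdisj i j hne) hi hj
  have hnc : ∀ i j, i ≠ j → ∀ x ∈ D i, ∀ y ∈ D j, ∀ x' ∈ D i, ∀ y' ∈ D j,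
      ¬ [x, y, x', y'] <+ w ++ w' := by
    intro i j hij x hx y hy x' hx' y' hy' hs
    refine hL.not_crossing (Finset.subset_univ _) (Finset.subset_univ _) (hDconn i) (hDconn j)
      (hDdisj i j hij) (hDsep i j hij) hx hx' hy hy' (hs.trans ?_)
    exact ((List.sublist_cons_self a w).append (List.sublist_cons_self a w'))
  have hboth : ∀ i, ∃ u ∈ D i, u ∈ w ∧ u ∈ w' := by
    intro i
    obtain ⟨v, hv⟩ := (hDconn i).nonempty
    obtain ⟨p⟩ := hconn.preconnected v a
    obtain ⟨d, -, hd, hd'⟩ := p.exists_boundary_dart (D i : Set V) hv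
      (fun h => (hmem a).2 ⟨i, h⟩ rfl)
    have hsnd : d.snd = a := by
      by_contra hne
      obtain ⟨j, hj⟩ := (hmem _).1 hne
      refine hDsep i j ?_ _ hd _ hj d.adj
      rintro rfl
      exact hd' hj
    exact ⟨d.fst, hd, hL.mem_and_mem_of_adj (Finset.mem_univ _) (Finset.mem_univ _)
      (hsnd ▸ d.adj.symm)⟩
  let P : Fin k → V → Bool := fun i v => decide (v ∈ D i)
  let key : Fin k → ℕ := fun i => w.findIdx (P i)
  have hkey : Function.Injective key := by
    intro i j hij
    obtain ⟨u, hu, huw, -⟩ := hboth i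
    obtain ⟨v, hv, hvw, -⟩ := hboth j
    have hi : key i < w.length := List.findIdx_lt_length_of_exists ⟨u, huw, by simpa [P] using hu⟩
    have hj : key j < w.length := List.findIdx_lt_length_of_exists ⟨v, hvw, by simpa [P] using hv⟩
    have h1 : P i w[key i] := List.findIdx_getElem (w := hi)
    have h2 : P j w[key j] := List.findIdx_getElem (w := hj)
    simp only [hij] at h1
    exact hunique i j _ (by simpa [P] using h1) (by simpa [P] using h2)
  have hsort : StrictMono (key ∘ Tuple.sort key) :=
    (Tuple.monotone_sort key).strictMono_of_injective (hkey.comp (Tuple.sort key).injective)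
  have hfirst : ∀ i j, key i < key j → ∀ x y, P i y → P j x → ¬ [x, y] <+ w := by
    intro i j hij x y hy hx hxy
    obtain ⟨z, hz, hs⟩ := exists_cons_sublist_of_findIdx_lt hij hx hxy
    obtain ⟨u, hu, -, huw⟩ := hboth j
    simp only [P, decide_eq_true_eq] at hx hy hz
    exact hnc i j (fun e => hij.ne (congrArg key e)) z hz x hx y hy u hu
      (hs.append (List.singleton_sublist.2 huw))
  have hsecond : ∀ i j, key i < key j → ∀ x y, P i x → P j y → ¬ [x, y] <+ w' := by
    intro i j hij x y hx hy hxy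
    obtain ⟨u, hu, huw, -⟩ := hboth j
    obtain ⟨z, hz, hs⟩ := exists_cons_sublist_of_findIdx_lt (t := []) hij
      (by simpa [P] using hu) (List.singleton_sublist.2 huw)
    simp only [P, decide_eq_true_eq] at hx hy hz
    exact hnc i j (fun e => hij.ne (congrArg key e)) z hz u hu x hx y hy (hs.append hxy)
  let js := List.ofFn (Tuple.sort key)
  have hjs : js.Pairwise fun i j => key i < key j := by
    rw [List.pairwise_ofFn]
    exact fun i j hij => hsort hij
  have hexcl : ∀ i j, key i ≠ key j → ∀ x, P i x → ¬ P j x := by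
    intro i j hij x hi hj
    simp only [P, decide_eq_true_eq] at hi hj
    exact hij (congrArg key (hunique i j x hi hj))
  have hcover : ∀ x, x ≠ a → ∃ j ∈ js, P j x := by
    intro x hx
    obtain ⟨i, hi⟩ := (hmem x).1 hx
    exact ⟨i, List.mem_ofFn.2 ⟨(Tuple.sort key).symm i, by simp⟩, by simpa [P] using hi⟩
  have hw : w = (js.map fun j => w.filter (P j)).flatten :=
    eq_flatten_filter (hjs.imp fun h => hfirst _ _ h) (hjs.imp fun h => hexcl _ _ h.ne)
      fun x hx => hcover x fun e => haw.1 (e ▸ hx)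
  have hw' : w' = (js.reverse.map fun j => w'.filter (P j)).flatten :=
    eq_flatten_filter
      (List.pairwise_reverse.2 (hjs.imp fun h x y hx hy => hsecond _ _ h x y hy hx))
      (List.pairwise_reverse.2 (hjs.imp fun h => hexcl _ _ h.ne'))
      fun x hx => by
        obtain ⟨j, hj, hjx⟩ := hcover x fun e => haw.2 (e ▸ hx)
        exact ⟨j, List.mem_reverse.2 hj, hjx⟩
  refine ⟨Tuple.sort key, fun i => w.filter (P i), fun i => w'.filter (P i), s.length, ?_, ?_⟩
  · rw [List.rotate_append_length_eq, hts]
    have e1 : List.ofFn (fun j => w.filter (P (Tuple.sort key j))) =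
        js.map fun j => w.filter (P j) := by
      rw [List.map_ofFn]
      rfl
    have e2 : (List.ofFn (fun j => w'.filter (P (Tuple.sort key j)))).reverse =
        js.reverse.map fun j => w'.filter (P j) := by
      rw [List.map_reverse, List.map_ofFn]
      rfl
    rw [e1, e2, ← hw, ← hw']
  · intro i
    have hfilter : ∀ v : List V, a ∉ v →
        v.filter (fun x => decide (x ∈ insert a (D i))) = v.filter (P i) := fun v hv =>
      List.filter_congr fun x hx => by
        have : x ≠ a := fun e => hv (e ▸ hx)
        simp [P, this]
    have h := hL.filter (Finset.subset_univ (insert a (D i)))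
    rwa [List.filter_append, List.filter_cons_of_pos (by simp), List.filter_cons_of_pos (by simp),
      hfilter w haw.1, hfilter w' haw.2] at h
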